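/- Let R be a left and right noetherian ring, S an Ore set of R consisting of non-zero-divisors, and 𝓕: 𝓜 → Ω a Fitting invariant. Then for any integer n ≥ 0, the following map 𝓕^[n]: 𝓜 → Ω is well-defined: for each M ∈ 𝓜, choose an exact sequence 0 → N → P_1 → ⋯ → P_n → M → 0 in 𝓜 with P_1, …, P_n ∈ 𝓟, and set 𝓕^[n](M) = (∏_{i=1}^n 𝓕(P_i)^{(-1)^i})·𝓕(N); the value is independent of the chosen sequence. Moreover, 𝓕^[n]: 𝓜 → Ω is again a Fitting invariant. -/

import Mathlib

open CategoryTheory MulOpposite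

noncomputable section

/-- `M` is `S`-torsion: every element is annihilated by some element of `S`. -/
def STorsion (R : Type) [Ring R] (S : Submonoid R) (M : Type) [AddCommGroup M] [Module R M] :
    Prop :=
  ∀ m : M, ∃ s ∈ S, s • m = 0

/-- Projective dimension `≤ n`, witnessed by resolutions with finite free stages. -/
def PdLE (R : Type) [Ring R] : ℕ → (M : Type) → [AddCommGroup M] → [Module R M] → Prop
  | 0, M, _, _ => Module.Projective R M
  | n+1, M, _, _ => ∃ (k : ℕ) (f : (Fin k → R) →ₗ[R] M),
      Function.Surjective f ∧ PdLE R n (LinearMap.ker f)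

/-- Finite projective dimension. -/
def FinitePd (R : Type) [Ring R] (M : Type) [AddCommGroup M] [Module R M] : Prop :=
  ∃ n, PdLE R n M

/-- Membership in the category `𝓜` of finitely generated `S`-torsion modules. -/
def MemM (R : Type) [Ring R] (S : Submonoid R) (M : Type) [AddCommGroup M] [Module R M] : Prop :=
  Module.Finite R M ∧ STorsion R S M

/-- Membership in `𝓟`: finitely generated `S`-torsion of projective dimension `≤ 1`. -/
def MemP (R : Type) [Ring R] (S : Submonoid R) (M : Type) [AddCommGroup M] [Module R M] : Prop :=
  MemM R S M ∧ PdLE R 1 M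

/-- Membership in `𝓠`: finitely generated `S`-torsion of finite projective dimension. -/
def MemQ (R : Type) [Ring R] (S : Submonoid R) (M : Type) [AddCommGroup M] [Module R M] : Prop :=
  MemM R S M ∧ FinitePd R M

/-- The Ext group `Ext^i_R(M, N)`. -/
abbrev extGroup (R : Type) [Ring R] (M N : Type) [AddCommGroup M] [Module R M]
    [AddCommGroup N] [Module R N] (i : ℕ) : Type :=
  (((_root_.Ext ℤ (ModuleCat R) i).obj (Opposite.op (ModuleCat.of R M))).obj (ModuleCat.of R N))

/-- Vanishing of `Ext^i_R(M, R)`. -/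
def ExtRVanish (R : Type) [Ring R] (M : Type) [AddCommGroup M] [Module R M] (i : ℕ) : Prop :=
  Subsingleton (extGroup R M R i)

/-- `pd*_R(M) ≤ 1`, i.e. `Ext^i_R(M, R) = 0` for all `i ≥ 2`. -/
def PdStarLE1 (R : Type) [Ring R] (M : Type) [AddCommGroup M] [Module R M] : Prop :=
  ∀ i, 2 ≤ i → ExtRVanish R M i

/-- Membership in `𝓒`: finitely generated `S`-torsion with `pd* ≤ 1`. -/
def MemC (R : Type) [Ring R] (S : Submonoid R) (M : Type) [AddCommGroup M] [Module R M] : Prop :=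
  MemM R S M ∧ PdStarLE1 R M

/-- Assumption (⋆): a uniform bound `d(R)` on `pd*` of all finitely generated left or
right `R`-modules. -/
def AssumptionStar (R : Type) [Ring R] : Prop :=
  ∃ d : ℕ,
    (∀ (M : Type) [AddCommGroup M] [Module R M], Module.Finite R M →
      ∀ i, d < i → ExtRVanish R M i) ∧
    (∀ (M : Type) [AddCommGroup M] [Module Rᵐᵒᵖ M], Module.Finite Rᵐᵒᵖ M →
      ∀ i, d < i → ExtRVanish Rᵐᵒᵖ M i)

/-- `S` is a (left and right) Ore set consisting of non-zero-divisors. -/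
def IsOreSet (R : Type) [Ring R] (S : Submonoid R) : Prop :=
  S ≤ nonZeroDivisors R ∧
    (∀ f ∈ S, ∀ a : R, ∃ r : R, ∃ s ∈ S, f * r = a * s) ∧
    (∀ f ∈ S, ∀ a : R, ∃ r : R, ∃ s ∈ S, r * f = s * a)

/-- A sequence of `R`-modules and maps, used to encode finite exact sequences. -/
structure ModSeq (R : Type) [Ring R] where
  C : ℕ → Type
  [acg : ∀ i, AddCommGroup (C i)]
  [mod : ∀ i, Module R (C i)]
  f : ∀ i, C i →ₗ[R] C (i+1)

attribute [instance] ModSeq.acg ModSeq.mod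

/-- `D.ExactTrunc n` : the window `0 → C 0 → C 1 → ⋯ → C (n+1) → 0` is exact. -/
def ModSeq.ExactTrunc {R : Type} [Ring R] (D : ModSeq R) (n : ℕ) : Prop :=
  Function.Injective (D.f 0) ∧ Function.Surjective (D.f n) ∧
    ∀ i < n, Function.Exact (D.f i) (D.f (i+1))

/-- The (initial) Fitting ideal of a module over a commutative ring. -/
def fittingIdeal (R : Type) [CommRing R] (M : Type) [AddCommGroup M] [Module R M] : Ideal R :=
  Ideal.span { x : R | ∃ (a : ℕ) (A : Matrix (Fin a) (Fin a) R) (π : (Fin a → R) →ₗ[R] M),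
    Function.Surjective π ∧ (∀ j, π (fun i => A i j) = 0) ∧ x = A.det }

/-- The Fitting ideal viewed as a fractional ideal, i.e. a finitely generated
`R`-submodule of `S⁻¹R`. -/
def fittFrac (R : Type) [CommRing R] (S : Submonoid R) (M : Type) [AddCommGroup M]
    [Module R M] : Submodule R (Localization S) :=
  Submodule.map (Algebra.linearMap R (Localization S)) (fittingIdeal R M)

/-- Precomposition with `ι`, as a map of right `R`-modules `Hom(F, R) → Hom(N, R)`. -/
def precompDual (R : Type) [Ring R] {N F : Type} [AddCommGroup N] [Module R N]
    [AddCommGroup F] [Module R F] (ι : N →ₗ[R] F) :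
    (F →ₗ[R] R) →ₗ[Rᵐᵒᵖ] (N →ₗ[R] R) where
  toFun g := g.comp ι
  map_add' _ _ := LinearMap.ext fun _ => rfl
  map_smul' _ _ := LinearMap.ext fun _ => rfl

/-- `Ext^1_R(M, R)` computed from a presentation `0 → N → F → M → 0` with `F` projective:
the cokernel of `Hom(F, R) → Hom(N, R)`; it is a right `R`-module. -/
abbrev ExtOneDual (R : Type) [Ring R] {N F : Type} [AddCommGroup N] [Module R N]
    [AddCommGroup F] [Module R F] (ι : N →ₗ[R] F) : Type :=
  (N →ₗ[R] R) ⧸ LinearMap.range (precompDual R ι)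

/-- Precomposition with `ι`, commutative case. -/
def precompDualComm (R : Type) [CommRing R] {N F : Type} [AddCommGroup N] [Module R N]
    [AddCommGroup F] [Module R F] (ι : N →ₗ[R] F) :
    (F →ₗ[R] R) →ₗ[R] (N →ₗ[R] R) where
  toFun g := g.comp ι
  map_add' _ _ := LinearMap.ext fun _ => rfl
  map_smul' _ _ := LinearMap.ext fun _ => rfl

/-- `Ext^1_R(M, R)` computed from a presentation, commutative case. -/
abbrev ExtOneDualComm (R : Type) [CommRing R] {N F : Type} [AddCommGroup N] [Module R N]
    [AddCommGroup F] [Module R F] (ι : N →ₗ[R] F) : Type :=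
  (N →ₗ[R] R) ⧸ LinearMap.range (precompDualComm R ι)

/-- A Fitting invariant `𝓕 : 𝓜 → Ω`. -/
def IsFittingInv (R : Type) [Ring R] (S : Submonoid R) {Ω : Type} [CommMonoid Ω]
    (F : (M : Type) → [AddCommGroup M] → [Module R M] → Ω) : Prop :=
  (∀ (P : Type) [AddCommGroup P] [Module R P], MemP R S P → IsUnit (F P)) ∧
  (∀ (M' M P : Type) [AddCommGroup M'] [Module R M'] [AddCommGroup M] [Module R M]
      [AddCommGroup P] [Module R P], MemM R S M' → MemM R S M → MemP R S P →
    ∀ (ι : M' →ₗ[R] M) (p : M →ₗ[R] P), Function.Injective ι → Function.Surjective p →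
      Function.Exact ι p → F M = F P * F M')

/-- A quasi-Fitting invariant `𝓕 : 𝓒 → Ω`. -/
def IsQuasiFittingInv (R : Type) [Ring R] (S : Submonoid R) {Ω : Type} [CommMonoid Ω]
    (F : (M : Type) → [AddCommGroup M] → [Module R M] → Ω) : Prop :=
  (∀ (P : Type) [AddCommGroup P] [Module R P], MemP R S P → IsUnit (F P)) ∧
  (∀ (M' M P : Type) [AddCommGroup M'] [Module R M'] [AddCommGroup M] [Module R M]
      [AddCommGroup P] [Module R P], MemC R S M' → MemC R S M → MemP R S P →
    ∀ (ι : M' →ₗ[R] M) (p : M →ₗ[R] P), Function.Injective ι → Function.Surjective p →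
      Function.Exact ι p → F M = F P * F M') ∧
  (∀ (P M M' : Type) [AddCommGroup P] [Module R P] [AddCommGroup M] [Module R M]
      [AddCommGroup M'] [Module R M'], MemP R S P → MemC R S M → MemC R S M' →
    ∀ (ι : P →ₗ[R] M) (p : M →ₗ[R] M'), Function.Injective ι → Function.Surjective p →
      Function.Exact ι p → F M = F P * F M')

/-- The membership predicate of `𝓜` as a family. -/
def MemMFam (R : Type) [Ring R] (S : Submonoid R) (M : Type) [AddCommGroup M] [Module R M] :
    Prop :=
  MemM R S M

/-- The membership predicate of `𝓒` as a family. -/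
def MemCFam (R : Type) [Ring R] (S : Submonoid R) (M : Type) [AddCommGroup M] [Module R M] :
    Prop :=
  MemC R S M

/-- `ω` is the value obtained from an exact sequence `0 → N → P₁ → ⋯ → Pₙ → M → 0`
(`n ≥ 0`), with all terms satisfying `Mem`, each `Pᵢ ∈ 𝓟`, via the formula
`ω = (∏ i, 𝓕(Pᵢ)^((-1)^i)) · 𝓕(N)`; inverses are recorded by witnesses `u`. -/
def PosShiftValue (R : Type) [Ring R] (S : Submonoid R) {Ω : Type} [CommMonoid Ω]
    (Mem : (M : Type) → [AddCommGroup M] → [Module R M] → Prop)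
    (F : (M : Type) → [AddCommGroup M] → [Module R M] → Ω) (n : ℕ)
    (M : Type) [AddCommGroup M] [Module R M] (ω : Ω) : Prop :=
  ∃ D : ModSeq R, D.ExactTrunc n ∧ Nonempty (D.C (n+1) ≃ₗ[R] M) ∧
    (∀ i, i ≤ n+1 → Mem (D.C i)) ∧ (∀ i, 1 ≤ i → i ≤ n → MemP R S (D.C i)) ∧
    ∃ u : ℕ → Ω, (∀ i, 1 ≤ i → i ≤ n → F (D.C i) * u i = 1) ∧
      ω = (∏ i ∈ Finset.range n, if (i+1) % 2 = 1 then u (i+1) else F (D.C (i+1))) * F (D.C 0)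

/-- `ω` is the value obtained from an exact sequence `0 → M → P_m → ⋯ → P₁ → N → 0`
(`m ≥ 1` corresponding to the shift `n = -m < 0`) via the formula
`ω = (∏ i, 𝓕(Pᵢ)^((-1)^i)) · 𝓕(N)`. -/
def NegShiftValue (R : Type) [Ring R] (S : Submonoid R) {Ω : Type} [CommMonoid Ω]
    (Mem : (M : Type) → [AddCommGroup M] → [Module R M] → Prop)
    (F : (M : Type) → [AddCommGroup M] → [Module R M] → Ω) (m : ℕ)
    (M : Type) [AddCommGroup M] [Module R M] (ω : Ω) : Prop :=
  ∃ D : ModSeq R, D.ExactTrunc m ∧ Nonempty (D.C 0 ≃ₗ[R] M) ∧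
    (∀ i, i ≤ m+1 → Mem (D.C i)) ∧ (∀ i, 1 ≤ i → i ≤ m → MemP R S (D.C i)) ∧
    ∃ u : ℕ → Ω, (∀ i, 1 ≤ i → i ≤ m → F (D.C i) * u i = 1) ∧
      ω = (∏ i ∈ Finset.range m, if (i+1) % 2 = 1 then u (m-i) else F (D.C (m-i))) * F (D.C (m+1))

/-- `ω` is the value of the `n`-th shift (`n ∈ ℤ`) of `F` at `M` computed from some
admissible exact sequence whose terms satisfy `Mem`. -/
def ShiftValue (R : Type) [Ring R] (S : Submonoid R) {Ω : Type} [CommMonoid Ω]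
    (Mem : (M : Type) → [AddCommGroup M] → [Module R M] → Prop)
    (F : (M : Type) → [AddCommGroup M] → [Module R M] → Ω) (n : ℤ)
    (M : Type) [AddCommGroup M] [Module R M] (ω : Ω) : Prop :=
  if 0 ≤ n then PosShiftValue R S Mem F n.toNat M ω else NegShiftValue R S Mem F (-n).toNat M ω

/-- The axioms for the family of shifts `{𝓕⁽ⁿ⁾ : 𝓜 → Ω}` of a quasi-Fitting invariant. -/
def IsShiftFamily (R : Type) [Ring R] (S : Submonoid R) {Ω : Type} [CommMonoid Ω]
    (F : (M : Type) → [AddCommGroup M] → [Module R M] → Ω)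
    (G : ℤ → (M : Type) → [AddCommGroup M] → [Module R M] → Ω) : Prop :=
  (∀ (M : Type) [AddCommGroup M] [Module R M], MemC R S M → G 0 M = F M) ∧
  (∀ (n : ℤ) (P : Type) [AddCommGroup P] [Module R P], MemQ R S P → IsUnit (G n P)) ∧
  (∀ (n : ℤ) (N P M : Type) [AddCommGroup N] [Module R N] [AddCommGroup P] [Module R P]
      [AddCommGroup M] [Module R M], MemM R S N → MemQ R S P → MemM R S M →
    ∀ (ι : N →ₗ[R] P) (p : P →ₗ[R] M), Function.Injective ι → Function.Surjective p →
      Function.Exact ι p → G n M = G n P * G (n-1) N) ∧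
  (∀ (n : ℤ) (M' M P : Type) [AddCommGroup M'] [Module R M'] [AddCommGroup M] [Module R M]
      [AddCommGroup P] [Module R P], MemM R S M' → MemM R S M → MemQ R S P →
    ∀ (ι : M' →ₗ[R] M) (p : M →ₗ[R] P), Function.Injective ι → Function.Surjective p →
      Function.Exact ι p → G n M = G n P * G n M') ∧
  (∀ (n : ℤ) (P M M' : Type) [AddCommGroup P] [Module R P] [AddCommGroup M] [Module R M]
      [AddCommGroup M'] [Module R M'], MemQ R S P → MemM R S M → MemM R S M' →
    ∀ (ι : P →ₗ[R] M) (p : M →ₗ[R] M'), Function.Injective ι → Function.Surjective p →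
      Function.Exact ι p → G n M = G n P * G n M')

end

section Modules

variable {R : Type} [Ring R] {S : Submonoid R}
  {M N P : Type} [AddCommGroup M] [Module R M] [AddCommGroup N] [Module R N]
  [AddCommGroup P] [Module R P]

theorem MemM.of_injective [IsNoetherianRing R] (h : MemM R S M) (f : N →ₗ[R] M)
    (hf : Function.Injective f) : MemM R S N := by
  obtain ⟨hfin, htor⟩ := h
  refine ⟨Module.Finite.of_injective f hf, fun x => ?_⟩
  obtain ⟨s, hs, hx⟩ := htor (f x)
  exact ⟨s, hs, hf (by simpa using hx)⟩

theorem MemM.of_surjective (h : MemM R S M) (f : M →ₗ[R] N) (hf : Function.Surjective f) :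
    MemM R S N := by
  obtain ⟨hfin, htor⟩ := h
  refine ⟨Module.Finite.of_surjective f hf, fun y => ?_⟩
  obtain ⟨x, rfl⟩ := hf y
  obtain ⟨s, hs, hx⟩ := htor x
  exact ⟨s, hs, by rw [← map_smul, hx, map_zero]⟩

/-- The submodule of `S`-torsion elements, for an Ore set `S`. -/
def oreTorsion (hS : IsOreSet R S) (M : Type) [AddCommGroup M] [Module R M] : Submodule R M where
  carrier := {m | ∃ s ∈ S, s • m = 0}
  zero_mem' := ⟨1, S.one_mem, smul_zero _⟩
  add_mem' := by
    rintro x y ⟨s, hs, hx⟩ ⟨t, ht, hy⟩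
    obtain ⟨r, u, hu, h⟩ := hS.2.2 s hs t
    refine ⟨u * t, S.mul_mem hu ht, ?_⟩
    rw [smul_add, mul_smul u t y, hy, smul_zero, ← h, mul_smul, hx, smul_zero, add_zero]
  smul_mem' := by
    rintro a x ⟨s, hs, hx⟩
    obtain ⟨r, u, hu, h⟩ := hS.2.2 s hs a
    refine ⟨u, hu, ?_⟩
    rw [← mul_smul, ← h, mul_smul, hx, smul_zero]

theorem sTorsion_of_oreTorsion_eq_top (hS : IsOreSet R S) (h : oreTorsion hS M = ⊤) :
    STorsion R S M := fun m => by
  have hm : m ∈ oreTorsion hS M := h ▸ Submodule.mem_top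
  exact hm

theorem MemM.prod (hS : IsOreSet R S) (hM : MemM R S M) (hN : MemM R S N) :
    MemM R S (M × N) := by
  have := hM.1
  have := hN.1
  refine ⟨inferInstance, sTorsion_of_oreTorsion_eq_top hS (eq_top_iff.2 ?_)⟩
  rintro ⟨x, y⟩ -
  obtain ⟨s, hs, hx⟩ := hM.2 x
  obtain ⟨t, ht, hy⟩ := hN.2 y
  have h₁ : (x, (0 : N)) ∈ oreTorsion hS (M × N) := ⟨s, hs, by simp [hx]⟩
  have h₂ : ((0 : M), y) ∈ oreTorsion hS (M × N) := ⟨t, ht, by simp [hy]⟩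
  simpa using add_mem h₁ h₂

theorem shortExact_of_linearMap {ι : M →ₗ[R] N} {p : N →ₗ[R] P} (hι : Function.Injective ι)
    (hp : Function.Surjective p) (h : Function.Exact ι p) :
    (ModuleCat.shortComplexOfCompEqZero ι p h.linearMap_comp_eq_zero).ShortExact :=
  ModuleCat.shortComplex_shortExact _ h hι hp

theorem pdLE_one_iff : PdLE R 1 M ↔
    Module.Finite R M ∧ HasProjectiveDimensionLT (ModuleCat.of R M) 2 := by
  have key {k : ℕ} (f : (Fin k → R) →ₗ[R] M) (hf : Function.Surjective f) :
      HasProjectiveDimensionLT (ModuleCat.of R M) 2 ↔ Module.Projective R (LinearMap.ker f) := by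
    rw [IsProjective.iff_projective, projective_iff_hasProjectiveDimensionLT_one]
    exact (LinearMap.shortExact_shortComplexKer hf).hasProjectiveDimensionLT_X₃_iff 0
      ((IsProjective.iff_projective (Fin k → R)).1 inferInstance)
  constructor
  · rintro ⟨k, f, hf, hker⟩
    exact ⟨Module.Finite.of_surjective f hf, (key f hf).2 hker⟩
  · rintro ⟨hfin, hpd⟩
    obtain ⟨k, f, hf⟩ := Module.Finite.exists_fin' R M
    exact ⟨k, f, hf, (key f hf).1 hpd⟩

/-- The class `𝓟` is closed under kernels of epimorphisms. -/
theorem MemP.of_exact [IsNoetherianRing R] (hN : MemP R S N) (hP : MemP R S P)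
    {ι : M →ₗ[R] N} {p : N →ₗ[R] P} (hι : Function.Injective ι)
    (hp : Function.Surjective p) (h : Function.Exact ι p) : MemP R S M := by
  have hM := hN.1.of_injective ι hι
  have hP₂ := (pdLE_one_iff.1 hP.2).2
  exact ⟨hM, pdLE_one_iff.2 ⟨hM.1, (shortExact_of_linearMap hι hp h).hasProjectiveDimensionLT_X₁ 2
    (pdLE_one_iff.1 hN.2).2 (hasProjectiveDimensionLT_of_ge (ModuleCat.of R P) 2 3 (by lia))⟩⟩

theorem MemP.of_subsingleton [Subsingleton M] : MemP R S M := by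
  have hfin : Module.Finite R M := inferInstance
  refine ⟨⟨hfin, fun m => ⟨1, S.one_mem, Subsingleton.elim _ _⟩⟩, pdLE_one_iff.2 ⟨hfin, ?_⟩⟩
  have := (IsProjective.iff_projective M).1 (inferInstance : Module.Projective R M)
  infer_instance

/-- Every object of `𝓜` is a quotient of an object of `𝓟`. -/
theorem MemM.exists_memP_surjective (hS : IsOreSet R S) (hM : MemM R S M) :
    ∃ (Q : Type) (_ : AddCommGroup Q) (_ : Module R Q) (q : Q →ₗ[R] M),
      MemP R S Q ∧ Function.Surjective q := by
  have := hM.1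
  obtain ⟨k, f, hf⟩ := Module.Finite.exists_fin' R M
  choose s hs hsf using fun i => hM.2 (f (Pi.single i 1))
  let d : (Fin k → R) →ₗ[R] (Fin k → R) :=
    LinearMap.pi fun i => LinearMap.toSpanSingleton R R (s i) ∘ₗ LinearMap.proj i
  have d_single (i : Fin k) : d (Pi.single i 1) = s i • Pi.single i 1 := by
    ext j
    by_cases hij : j = i
    · subst hij; simp [d]
    · simp [d, hij]
  have hd : Function.Injective d := fun x y hxy => funext fun i =>
    (mul_cancel_right_mem_nonZeroDivisors (hS.1 (hs i))).1 (congrFun hxy i)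
  have hfd : LinearMap.range d ≤ LinearMap.ker f := by
    rw [LinearMap.range_le_ker_iff]
    ext i
    simp [d_single, hsf]
  refine ⟨(Fin k → R) ⧸ LinearMap.range d, inferInstance, inferInstance,
    (LinearMap.range d).liftQ f hfd, ⟨⟨inferInstance, ?_⟩, pdLE_one_iff.2 ⟨inferInstance, ?_⟩⟩, ?_⟩
  · refine sTorsion_of_oreTorsion_eq_top hS (eq_top_iff.2 ?_)
    rintro y -
    obtain ⟨x, rfl⟩ := (LinearMap.range d).mkQ_surjective y
    rw [LinearMap.pi_apply_eq_sum_univ (LinearMap.range d).mkQ x]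
    refine sum_mem fun i _ => Submodule.smul_mem _ _ ⟨s i, hs i, ?_⟩
    rw [← map_smul]
    refine (Submodule.Quotient.mk_eq_zero _).2 ⟨Pi.single i 1, ?_⟩
    rw [d_single]
    congr 1
    ext j
    simp [Pi.single_apply, eq_comm]
  · have hfree := (IsProjective.iff_projective (R := R) (Fin k → R)).1 inferInstance
    exact ((shortExact_of_linearMap hd (LinearMap.range d).mkQ_surjective
      (LinearMap.exact_map_mkQ_range d)).hasProjectiveDimensionLT_X₃_iff 0 hfree).2
        (projective_iff_hasProjectiveDimensionLT_one.1 hfree)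
  · intro m
    obtain ⟨x, rfl⟩ := hf m
    exact ⟨(LinearMap.range d).mkQ x, by simp⟩

end Modules

section Shift

variable {R : Type} [Ring R] {S : Submonoid R} {Ω : Type} [CommMonoid Ω]
  {F G : (M : Type) → [AddCommGroup M] → [Module R M] → Ω}

theorem IsFittingInv.map_subsingleton (hF : IsFittingInv R S F) (M : Type) [AddCommGroup M]
    [Module R M] [Subsingleton M] : F M = 1 := by
  have hM : MemP R S M := .of_subsingleton
  have h := hF.2 M M M hM.1 hM.1 hM LinearMap.id LinearMap.id Function.injective_id
    Function.surjective_id fun x => by simp [Subsingleton.elim x 0]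
  exact (hF.1 M hM).mul_eq_left.1 h.symm

theorem IsFittingInv.map_equiv (hF : IsFittingInv R S F) {M N : Type} [AddCommGroup M]
    [Module R M] [AddCommGroup N] [Module R N] (e : M ≃ₗ[R] N) (hM : MemM R S M) :
    F M = F N := by
  have h := hF.2 M N PUnit hM (hM.of_surjective e.toLinearMap e.surjective) .of_subsingleton
    e.toLinearMap 0 e.injective (fun _ => ⟨0, Subsingleton.elim _ _⟩)
    (fun y => by simp)
  rw [h, hF.map_subsingleton PUnit, one_mul]

/-- `G` is the first shift of `F`: `G M = F(P)⁻¹ F(N)` for every exact sequence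
`0 → N → P → M → 0` with `P ∈ 𝓟`. -/
def IsFirstShift (R : Type) [Ring R] (S : Submonoid R) {Ω : Type} [CommMonoid Ω]
    (F G : (M : Type) → [AddCommGroup M] → [Module R M] → Ω) : Prop :=
  ∀ (N P M : Type) [AddCommGroup N] [Module R N] [AddCommGroup P] [Module R P]
    [AddCommGroup M] [Module R M], MemP R S P →
    ∀ (ι : N →ₗ[R] P) (p : P →ₗ[R] M), Function.Injective ι → Function.Surjective p →
      Function.Exact ι p → F P * G M = F N

/-- Schanuel-type comparison of two presentations of the same module. -/
theorem IsFittingInv.mul_comm_of_presentations [IsNoetherianRing R] (hS : IsOreSet R S)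
    (hF : IsFittingInv R S F) {M N P N' P' : Type} [AddCommGroup M] [Module R M]
    [AddCommGroup N] [Module R N] [AddCommGroup P] [Module R P]
    [AddCommGroup N'] [Module R N'] [AddCommGroup P'] [Module R P']
    (hP : MemP R S P) (hP' : MemP R S P')
    {ι : N →ₗ[R] P} {p : P →ₗ[R] M} (hι : Function.Injective ι) (hp : Function.Surjective p)
    (h : Function.Exact ι p)
    {ι' : N' →ₗ[R] P'} {p' : P' →ₗ[R] M} (hι' : Function.Injective ι')
    (hp' : Function.Surjective p') (h' : Function.Exact ι' p') :
    F P * F N' = F P' * F N := by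
  let X : Submodule R (P × P') :=
    LinearMap.eqLocus (p ∘ₗ LinearMap.fst R P P') (p' ∘ₗ LinearMap.snd R P P')
  have hX : MemM R S X := (hP.1.prod hS hP'.1).of_injective X.subtype X.injective_subtype
  have mem_X (x : P × P') : x ∈ X ↔ p x.1 = p' x.2 := Iff.rfl
  let j : N →ₗ[R] X := (LinearMap.inl R P P' ∘ₗ ι).codRestrict X fun n => by
    simp [mem_X, h.apply_apply_eq_zero]
  let j' : N' →ₗ[R] X := (LinearMap.inr R P P' ∘ₗ ι').codRestrict X fun n => by
    simp [mem_X, h'.apply_apply_eq_zero]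
  have e₁ : F X = F P * F N' := by
    refine hF.2 N' X P (hP'.1.of_injective ι' hι') hX hP j' (LinearMap.fst R P P' ∘ₗ X.subtype)
      (fun a b hab => hι' (congrArg (fun x : X => x.1.2) hab)) (fun a => ?_) ?_
    · obtain ⟨b, hb⟩ := hp' (p a)
      exact ⟨⟨(a, b), hb.symm⟩, rfl⟩
    · rintro ⟨⟨a, b⟩, hab⟩
      constructor
      · rintro (rfl : a = 0)
        obtain ⟨n, rfl⟩ := (h' b).1 (by simpa [mem_X] using ((mem_X _).1 hab).symm)
        exact ⟨n, rfl⟩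
      · rintro ⟨n, hn⟩
        exact (congrArg (fun x : X => x.1.1) hn).symm
  have e₂ : F X = F P' * F N := by
    refine hF.2 N X P' (hP.1.of_injective ι hι) hX hP' j (LinearMap.snd R P P' ∘ₗ X.subtype)
      (fun a b hab => hι (congrArg (fun x : X => x.1.1) hab)) (fun b => ?_) ?_
    · obtain ⟨a, ha⟩ := hp (p' b)
      exact ⟨⟨(a, b), ha⟩, rfl⟩
    · rintro ⟨⟨a, b⟩, hab⟩
      constructor
      · rintro (rfl : b = 0)
        obtain ⟨n, rfl⟩ := (h a).1 (by simpa [mem_X] using (mem_X _).1 hab)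
        exact ⟨n, rfl⟩
      · rintro ⟨n, hn⟩
        exact (congrArg (fun x : X => x.1.2) hn).symm
  exact e₁.symm.trans e₂

theorem IsFittingInv.exists_isFirstShift [IsNoetherianRing R] (hS : IsOreSet R S)
    (hF : IsFittingInv R S F) :
    ∃ G : (M : Type) → [AddCommGroup M] → [Module R M] → Ω, IsFirstShift R S F G := by
  have key (M : Type) [AddCommGroup M] [Module R M] : ∃ ω : Ω,
      ∀ (N P : Type) [AddCommGroup N] [Module R N] [AddCommGroup P] [Module R P], MemP R S P →
        ∀ (ι : N →ₗ[R] P) (p : P →ₗ[R] M), Function.Injective ι → Function.Surjective p →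
          Function.Exact ι p → F P * ω = F N := by
    by_cases hM : MemM R S M
    · obtain ⟨Q, _, _, q, hQ, hq⟩ := hM.exists_memP_surjective hS
      obtain ⟨u, hu⟩ := hF.1 Q hQ
      refine ⟨↑u⁻¹ * F (LinearMap.ker q), fun N P _ _ _ _ hP ι p hι hp h => ?_⟩
      have e := hF.mul_comm_of_presentations hS hP hQ hι hp h
        (LinearMap.ker q).injective_subtype hq (LinearMap.exact_subtype_ker_map q)
      rw [mul_left_comm, e, ← hu, Units.inv_mul_cancel_left]
    · exact ⟨1, fun N P _ _ _ _ hP ι p _ hp _ => (hM (hP.1.of_surjective p hp)).elim⟩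
  exact ⟨fun M _ _ => (key M).choose, fun N P M _ _ _ _ _ _ hP ι p hι hp h =>
    (key M).choose_spec N P hP ι p hι hp h⟩

theorem IsFirstShift.mul_eq_one (hG : IsFirstShift R S F G) (hF : IsFittingInv R S F)
    (P : Type) [AddCommGroup P] [Module R P] (hP : MemP R S P) : F P * G P = 1 := by
  rw [hG PUnit P P hP 0 LinearMap.id (Function.injective_of_subsingleton _)
    Function.surjective_id (fun x => by simp [eq_comm]), hF.map_subsingleton]

theorem IsFirstShift.isFittingInv [IsNoetherianRing R] (hS : IsOreSet R S)
    (hG : IsFirstShift R S F G) (hF : IsFittingInv R S F) : IsFittingInv R S G := by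
  refine ⟨fun P _ _ hP => .of_mul_eq_one_right _ (hG.mul_eq_one hF P hP), ?_⟩
  intro M' M P _ _ _ _ _ _ hM' hM hP ι p hι hp h
  obtain ⟨Q, _, _, q, hQ, hq⟩ := hM.exists_memP_surjective hS
  let Q' : Submodule R Q := LinearMap.ker (p ∘ₗ q)
  have hpq : Function.Surjective (p ∘ₗ q) := hp.comp hq
  have hQ' : MemP R S Q' :=
    hQ.of_exact hP Q'.injective_subtype hpq (LinearMap.exact_subtype_ker_map _)
  have eQ : F Q = F P * F Q' := hF.2 Q' Q P hQ'.1 hQ.1 hP Q'.subtype (p ∘ₗ q)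
    Q'.injective_subtype hpq (LinearMap.exact_subtype_ker_map _)
  have eM : F Q * G M = F (LinearMap.ker q) := hG (LinearMap.ker q) Q M hQ _ q
    (LinearMap.ker q).injective_subtype hq (LinearMap.exact_subtype_ker_map q)
  let e := LinearEquiv.ofInjective ι hι
  let q' : Q' →ₗ[R] M' := e.symm.toLinearMap ∘ₗ
    (q ∘ₗ Q'.subtype).codRestrict (LinearMap.range ι) fun x => (h _).1 x.2
  have ι_q' (x : Q') : ι (q' x) = q x := by
    rw [← LinearEquiv.ofInjective_apply ι (h := hι)]
    simp only [q', e, LinearMap.coe_comp, LinearEquiv.coe_coe, Function.comp_apply,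
      LinearEquiv.apply_symm_apply]
    rfl
  have eM' : F Q' * G M' = F (LinearMap.ker q) := by
    refine hG (LinearMap.ker q) Q' M' hQ'
      (Submodule.inclusion (LinearMap.ker_le_ker_comp q p)) q'
      (Submodule.inclusion_injective _) (fun m => ?_) (fun x => ?_)
    · obtain ⟨y, hy⟩ := hq (ι m)
      refine ⟨⟨y, by simp [Q', hy, h.apply_apply_eq_zero]⟩, hι ?_⟩
      rw [ι_q', hy]
    · rw [← map_eq_zero_iff ι hι, ι_q']
      exact ⟨fun hx => ⟨⟨x, hx⟩, rfl⟩, by rintro ⟨y, rfl⟩; exact y.2⟩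
  have hGP := hG.mul_eq_one hF P hP
  have hu := hF.1 Q hQ
  apply hu.mul_left_cancel
  rw [eM, ← eM', eQ]
  calc F Q' * G M' = F P * G P * (F Q' * G M') := by rw [hGP, one_mul]
    _ = F P * F Q' * (G P * G M') := mul_mul_mul_comm _ _ _ _

/-- The sequence `0 → im f₁ → C 2 → C 3 → ⋯` obtained from `C 0 → C 1 → C 2 → ⋯`. -/
def ModSeq.truncate (D : ModSeq R) : ModSeq R where
  C
    | 0 => LinearMap.range (D.f 1)
    | i + 1 => D.C (i + 2)
  acg
    | 0 => inferInstanceAs (AddCommGroup (LinearMap.range (D.f 1)))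
    | i + 1 => D.acg (i + 2)
  mod
    | 0 => inferInstanceAs (Module R (LinearMap.range (D.f 1)))
    | i + 1 => D.mod (i + 2)
  f
    | 0 => (LinearMap.range (D.f 1)).subtype
    | i + 1 => D.f (i + 2)

theorem ModSeq.ExactTrunc.truncate {D : ModSeq R} {n : ℕ} (hD : D.ExactTrunc (n + 1)) :
    D.truncate.ExactTrunc n := by
  obtain ⟨-, hsurj, hexact⟩ := hD
  refine ⟨(LinearMap.range (D.f 1)).injective_subtype, ?_, ?_⟩
  · cases n with
    | zero =>
      intro y
      obtain ⟨x, rfl⟩ := hsurj y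
      exact ⟨⟨D.f 1 x, x, rfl⟩, rfl⟩
    | succ n => exact hsurj
  · rintro (_ | i) hi
    · intro y
      refine (hexact 1 (by lia) y).trans ⟨?_, ?_⟩
      · rintro ⟨x, rfl⟩
        exact ⟨⟨D.f 1 x, x, rfl⟩, rfl⟩
      · rintro ⟨⟨_, x, rfl⟩, rfl⟩
        exact ⟨x, rfl⟩
    · exact hexact (i + 2) (by lia)

theorem IsFirstShift.posShiftValue [IsNoetherianRing R] (hG : IsFirstShift R S F G)
    (hF : IsFittingInv R S F) {n : ℕ} {M : Type} [AddCommGroup M] [Module R M] {ω : Ω}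
    (h : PosShiftValue R S (MemMFam R S) F (n + 1) M ω) :
    PosShiftValue R S (MemMFam R S) G n M ω := by
  obtain ⟨D, hD, ⟨e⟩, hMem, hP, u, hu, rfl⟩ := h
  have hK : F (D.C 1) * G (LinearMap.range (D.f 1)) = F (D.C 0) :=
    hG (D.C 0) (D.C 1) (LinearMap.range (D.f 1)) (hP 1 le_rfl (by lia)) (D.f 0)
      (D.f 1).rangeRestrict hD.1 (D.f 1).surjective_rangeRestrict fun x => by
        rw [← hD.2.2 0 (by lia) x, ← Subtype.coe_inj]; rfl
  have hGu (i : ℕ) (h₁ : 1 ≤ i) (h₂ : i ≤ n + 1) : G (D.C i) = u i :=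
    (hF.1 _ (hP i h₁ h₂)).mul_left_cancel <| by
      rw [hG.mul_eq_one hF _ (hP i h₁ h₂), hu i h₁ h₂]
  refine ⟨D.truncate, hD.truncate, ⟨e⟩, ?_, ?_, fun i => F (D.C (i + 1)), ?_, ?_⟩
  · rintro (_ | i) hi
    · exact MemM.of_injective (hMem 2 (by lia)) (LinearMap.range (D.f 1)).subtype
        (LinearMap.range (D.f 1)).injective_subtype
    · exact hMem (i + 2) (by lia)
  · rintro (_ | i) h₁ h₂
    · lia
    · exact hP (i + 2) (by lia) (by lia)
  · rintro (_ | i) h₁ h₂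
    · lia
    · rw [mul_comm]
      exact hG.mul_eq_one hF _ (hP (i + 2) (by lia) (by lia))
  · have hG₀ : u 1 * F (D.C 0) = G (LinearMap.range (D.f 1)) := by
      rw [← hK, ← mul_assoc, mul_comm (u 1), hu 1 le_rfl (by lia), one_mul]
    rw [Finset.prod_range_succ', mul_assoc]
    refine congrArg₂ _ (Finset.prod_congr rfl fun i hi => ?_) hG₀
    have hi : i < n := Finset.mem_range.1 hi
    rw [← hGu (i + 1 + 1) (by lia) (by lia)]
    rcases Nat.mod_two_eq_zero_or_one i with h₀ | h₀
    · rw [if_neg (by lia), if_pos (by lia)]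
    · rw [if_pos (by lia), if_neg (by lia)]
      rfl

theorem IsFittingInv.eq_of_posShiftValue_zero (hF : IsFittingInv R S F) {M : Type}
    [AddCommGroup M] [Module R M] {ω : Ω} (h : PosShiftValue R S (MemMFam R S) F 0 M ω) :
    ω = F M := by
  obtain ⟨D, ⟨hinj, hsurj, -⟩, ⟨e⟩, hMem, -, u, -, rfl⟩ := h
  simpa using hF.map_equiv ((LinearEquiv.ofBijective (D.f 0) ⟨hinj, hsurj⟩).trans e)
    (hMem 0 (by lia))

end Shift

/-- For a Fitting invariant `𝓕 : 𝓜 → Ω` over a left and right noetherian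
ring `R` with an Ore set `S` of non-zero-divisors, the `n`-th shift `𝓕^[n]` is well-defined
(the value computed from any exact sequence `0 → N → P₁ → ⋯ → Pₙ → M → 0` in `𝓜` with
`Pᵢ ∈ 𝓟` is independent of the sequence), and any map `G` computing these values is again
a Fitting invariant. -/
theorem statement1
    (R : Type) [Ring R] [IsNoetherianRing R] [IsNoetherianRing Rᵐᵒᵖ]
    (S : Submonoid R) (hS : IsOreSet R S)
    (Ω : Type) [CommMonoid Ω]
    (F : (M : Type) → [AddCommGroup M] → [Module R M] → Ω)
    (hF : IsFittingInv R S F) (n : ℕ) :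
    (∀ (M : Type) [AddCommGroup M] [Module R M], MemM R S M →
      ∀ ω ω' : Ω, PosShiftValue R S (MemMFam R S) F n M ω →
        PosShiftValue R S (MemMFam R S) F n M ω' → ω = ω') ∧
    (∀ G : (M : Type) → [AddCommGroup M] → [Module R M] → Ω,
      (∀ (M : Type) [AddCommGroup M] [Module R M], MemM R S M →
        PosShiftValue R S (MemMFam R S) F n M (G M)) →
      IsFittingInv R S G) := by
  induction n generalizing F with
  | zero =>
    refine ⟨fun M _ _ _ ω ω' h h' => ?_, fun G hG => ?_⟩
    · rw [hF.eq_of_posShiftValue_zero h, hF.eq_of_posShiftValue_zero h']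
    · have hGF (M : Type) [AddCommGroup M] [Module R M] (hM : MemM R S M) : G M = F M :=
        hF.eq_of_posShiftValue_zero (hG M hM)
      refine ⟨fun P _ _ hP => hGF P hP.1 ▸ hF.1 P hP, ?_⟩
      intro M' M P _ _ _ _ _ _ hM' hM hP ι p hι hp h
      rw [hGF M hM, hGF P hP.1, hGF M' hM']
      exact hF.2 M' M P hM' hM hP ι p hι hp h
  | succ n ih =>
    obtain ⟨F₁, hF₁⟩ := hF.exists_isFirstShift hS
    obtain ⟨ih₁, ih₂⟩ := ih F₁ (hF₁.isFittingInv hS hF)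
    exact ⟨fun M _ _ hM ω ω' h h' =>
        ih₁ M hM ω ω' (hF₁.posShiftValue hF h) (hF₁.posShiftValue hF h'),
      fun G hG => ih₂ G fun M _ _ hM => hF₁.posShiftValue hF (hG M hM)⟩
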